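/- arXiv:2501.18127 — 8 statements merged into one kernel-verified Lean document; each statement's English description precedes it below -/
import Mathlib

section
/- Let R > 0 and let μ, λ be real numbers. Suppose μ ≥ −3(2R)^{2/3} and λ > (−μ² − (Y₁^{1/3} + Y₂^{1/3}))/12, where Y₁ = μ⁶ + 2160R²μ³ − 93312R⁴ + 48√3·R·√((μ³ + 108R²)³) and Y₂ = μ⁶ + 2160R²μ³ − 93312R⁴ − 48√3·R·√((μ³ + 108R²)³). Then the cubic equation x³ − μx² − λx + 4R² = 0 has two distinct positive real solutions. -/
/-- A real number satisfying the depressed cubic with Cardano root `u + v` either equals `u + v`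
or is the double root `-u = -v`. -/
lemma eq_add_or_eq_neg_of_cardano {x u v : ℝ} (h : x ^ 3 = u ^ 3 + v ^ 3 + 3 * (u * v) * x) :
    x = u + v ∨ (u = v ∧ x = -u) := by
  have hfac : (x - (u + v)) * ((x + u) ^ 2 + (x + v) ^ 2 + (u - v) ^ 2) = 0 := by
    linear_combination 2 * h
  rcases mul_eq_zero.mp hfac with h | h
  · left; linarith
  · right
    have huv : u - v = 0 := by
      apply pow_eq_zero_iff two_ne_zero |>.mp
      linarith [sq_nonneg (x + u), sq_nonneg (x + v), sq_nonneg (u - v)]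
    have hxu : x + u = 0 := by
      apply pow_eq_zero_iff two_ne_zero |>.mp
      linarith [sq_nonneg (x + u), sq_nonneg (x + v), sq_nonneg (u - v)]
    exact ⟨by linarith, by linarith⟩

/-- The function `x ^ 2 - μ * x + a / x` has a critical point on the positive half-line. -/
lemma exists_pos_two_mul_cube_sub_eq (μ : ℝ) {a : ℝ} (ha : 0 < a) :
    ∃ t : ℝ, 0 < t ∧ 2 * t ^ 3 - μ * t ^ 2 = a := by
  set M := |μ| + a + 1 with hM
  have hM1 : 1 ≤ M := by linarith [abs_nonneg μ]
  have hcont : ContinuousOn (fun x : ℝ => 2 * x ^ 3 - μ * x ^ 2) (Set.Icc 0 M) := by fun_prop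
  have hle : a ≤ 2 * M ^ 3 - μ * M ^ 2 := by
    have h : a ≤ 2 * M - μ := by linarith [le_abs_self μ, abs_nonneg μ]
    nlinarith [mul_le_mul_of_nonneg_left h (sq_nonneg M), one_le_pow₀ hM1 (n := 2)]
  obtain ⟨t, ⟨ht, -⟩, hta⟩ := intermediate_value_Icc (by linarith) hcont
    (show a ∈ Set.Icc _ _ from ⟨by simpa using ha.le, hle⟩)
  refine ⟨t, lt_of_le_of_ne ht ?_, hta⟩
  rintro rfl
  simp at hta
  exact ha.ne hta

/-- A monic real cubic, positive at zero and negative at some positive point, has two distinct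
positive roots. -/
lemma exists_two_pos_roots_of_neg {μ l a t : ℝ} (ha : 0 < a) (ht : 0 < t)
    (hneg : t ^ 3 - μ * t ^ 2 - l * t + a < 0) :
    ∃ x y : ℝ, 0 < x ∧ 0 < y ∧ x ≠ y ∧
      x ^ 3 - μ * x ^ 2 - l * x + a = 0 ∧ y ^ 3 - μ * y ^ 2 - l * y + a = 0 := by
  have hcont : Continuous (fun x : ℝ => x ^ 3 - μ * x ^ 2 - l * x + a) := by fun_prop
  set M := |μ| + |l| + 1 + t with hM
  have hM1 : 1 ≤ M := by linarith [abs_nonneg μ, abs_nonneg l]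
  have htM : t < M := by linarith [abs_nonneg μ, abs_nonneg l]
  have hpos : 0 < M ^ 3 - μ * M ^ 2 - l * M + a := by
    have h1 : |l| ≤ M - μ := by linarith [le_abs_self μ]
    have h2 : 0 ≤ M * (M - μ) - l := by
      nlinarith [le_abs_self l, abs_nonneg l]
    nlinarith [mul_nonneg (by linarith : (0 : ℝ) ≤ M) h2]
  obtain ⟨x, ⟨hx0, hxt⟩, hx⟩ := intermediate_value_Ioo' ht.le hcont.continuousOn
    (show (0 : ℝ) ∈ Set.Ioo _ _ from ⟨hneg, by simpa using ha⟩)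
  obtain ⟨y, ⟨hyt, -⟩, hy⟩ := intermediate_value_Ioo htM.le hcont.continuousOn
    (show (0 : ℝ) ∈ Set.Ioo _ _ from ⟨hneg, hpos⟩)
  exact ⟨x, y, hx0, ht.trans hyt, (hxt.trans hyt).ne, hx, hy⟩

/-- If `μ ≥ -3(2R)^(2/3)` and `λ` is greater than the stated bound built
from the real cube roots of `Y₁` and `Y₂`, then `x³ - μx² - λx + 4R² = 0` has two
distinct positive real solutions. -/
theorem stmt0 (R μ lam Y₁ Y₂ c₁ c₂ : ℝ) (hR : 0 < R)
    (hY₁ : Y₁ = μ ^ 6 + 2160 * R ^ 2 * μ ^ 3 - 93312 * R ^ 4 +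
      48 * Real.sqrt 3 * R * Real.sqrt ((μ ^ 3 + 108 * R ^ 2) ^ 3))
    (hY₂ : Y₂ = μ ^ 6 + 2160 * R ^ 2 * μ ^ 3 - 93312 * R ^ 4 -
      48 * Real.sqrt 3 * R * Real.sqrt ((μ ^ 3 + 108 * R ^ 2) ^ 3))
    (hc₁ : c₁ ^ 3 = Y₁) (hc₂ : c₂ ^ 3 = Y₂)
    (hμ : μ ≥ -3 * (2 * R) ^ ((2 : ℝ) / 3))
    (hlam : lam > (-μ ^ 2 - (c₁ + c₂)) / 12) :
    ∃ x y : ℝ, 0 < x ∧ 0 < y ∧ x ≠ y ∧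
      x ^ 3 - μ * x ^ 2 - lam * x + 4 * R ^ 2 = 0 ∧
      y ^ 3 - μ * y ^ 2 - lam * y + 4 * R ^ 2 = 0 := by
  have hdisc : 0 ≤ μ ^ 3 + 108 * R ^ 2 := by
    have hs : ((2 * R) ^ ((2 : ℝ) / 3)) ^ 3 = (2 * R) ^ 2 := by
      rw [← Real.rpow_natCast, ← Real.rpow_mul (by positivity)]
      norm_num
    have h := (Odd.strictMono_pow (R := ℝ) (n := 3) (by decide)).monotone hμ
    simp only [mul_pow, hs] at h
    linarith
  have h3 : Real.sqrt 3 ^ 2 = 3 := Real.sq_sqrt (by norm_num)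
  have hD : Real.sqrt ((μ ^ 3 + 108 * R ^ 2) ^ 3) ^ 2 = (μ ^ 3 + 108 * R ^ 2) ^ 3 :=
    Real.sq_sqrt (by positivity)
  have hcc : c₁ * c₂ = μ ^ 4 - 864 * R ^ 2 * μ := by
    apply (Odd.strictMono_pow (R := ℝ) (n := 3) (by decide)).injective
    simp only [mul_pow c₁]
    rw [hc₁, hc₂, hY₁, hY₂]
    linear_combination (-2304 * R ^ 2 * Real.sqrt ((μ ^ 3 + 108 * R ^ 2) ^ 3) ^ 2) * h3 -
      6912 * R ^ 2 * hD
  obtain ⟨t, ht, hta⟩ := exists_pos_two_mul_cube_sub_eq μ (a := 4 * R ^ 2) (by positivity)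
  have hR2 : R ^ 2 = (2 * t ^ 3 - μ * t ^ 2) / 4 := by linarith
  have hR4 : R ^ 4 = ((2 * t ^ 3 - μ * t ^ 2) / 4) ^ 2 := by rw [← hR2]; ring
  have hsum : c₁ + c₂ = -μ ^ 2 + 24 * μ * t - 36 * t ^ 2 := by
    rcases eq_add_or_eq_neg_of_cardano (x := -μ ^ 2 + 24 * μ * t - 36 * t ^ 2) (u := c₁) (v := c₂)
      (by rw [hcc, hc₁, hc₂, hY₁, hY₂, hR2, hR4]; ring) with h | ⟨h, hx⟩
    · exact h.symm
    · exfalso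
      have hYY : Y₁ = Y₂ := by rw [← hc₁, ← hc₂, h]
      have hprod : Real.sqrt 3 * R * Real.sqrt ((μ ^ 3 + 108 * R ^ 2) ^ 3) = 0 := by linarith
      have hsqrt : Real.sqrt ((μ ^ 3 + 108 * R ^ 2) ^ 3) = 0 :=
        (mul_eq_zero.mp hprod).resolve_left (by positivity)
      have hμ3 : μ ^ 3 = -108 * R ^ 2 := by
        rw [hsqrt] at hD
        have : μ ^ 3 + 108 * R ^ 2 = 0 := by
          apply pow_eq_zero_iff three_ne_zero |>.mp
          linarith
        linarith
      have hμneg : μ < 0 := by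
        apply (Odd.pow_neg_iff (n := 3) (by decide)).mp
        rw [hμ3]; nlinarith [pow_pos hR 2]
      have hc : c₁ < 0 := by
        apply (Odd.pow_neg_iff (n := 3) (by decide)).mp
        rw [hc₁, hY₁, hsqrt, show μ ^ 6 = (μ ^ 3) ^ 2 by ring, hμ3]
        nlinarith [pow_pos hR 4]
      nlinarith [mul_pos_of_neg_of_neg hμneg (neg_lt_zero.mpr ht), sq_nonneg μ, sq_nonneg t]
  apply exists_two_pos_roots_of_neg (by positivity) ht
  have hl : 3 * t ^ 2 - 2 * μ * t < lam := by rw [hsum] at hlam; linarith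
  linarith [mul_lt_mul_of_pos_right hl ht]
end

section
/- Let C₂ > 3·4^{1/3} and let a > b > 0 > c be the three distinct real roots of the cubic x³ − C₂x + 4, and set r = √C₂. Then r > a, and 0 < (a − b)(c − r)/((a − c)(b − r)) < 1. -/
/-- For `C₂ > 3·4^(1/3)`, with roots `a > b > 0 > c` of `x³ - C₂x + 4`
and `r = √C₂`, one has `r > a` and `0 < (a-b)(c-r)/((a-c)(b-r)) < 1`. -/
theorem stmt6 (C₂ a b c r : ℝ) (hC₂ : C₂ > 3 * (4 : ℝ) ^ ((1 : ℝ) / 3))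
    (hab : a > b) (hb : b > 0) (hc : 0 > c)
    (ha : a ^ 3 - C₂ * a + 4 = 0)
    (hbr : b ^ 3 - C₂ * b + 4 = 0)
    (hcr : c ^ 3 - C₂ * c + 4 = 0)
    (hr : r = Real.sqrt C₂) :
    r > a ∧ 0 < (a - b) * (c - r) / ((a - c) * (b - r)) ∧
      (a - b) * (c - r) / ((a - c) * (b - r)) < 1 := by
  have hC : 0 < C₂ := lt_trans (by positivity) hC₂
  have hr0 : 0 < r := hr ▸ Real.sqrt_pos.mpr hC
  have hsq : r ^ 2 = C₂ := by rw [hr, Real.sq_sqrt hC.le]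
  have hra : a < r := by
    have hprod : 0 < a * (r ^ 2 - a ^ 2) := by rw [hsq]; linarith
    have hdiff : 0 < r ^ 2 - a ^ 2 := pos_of_mul_pos_right hprod (by linarith)
    exact lt_of_pow_lt_pow_left₀ 2 hr0.le (by linarith)
  have hden : (a - c) * (b - r) < 0 :=
    mul_neg_of_pos_of_neg (by linarith) (by linarith)
  refine ⟨hra, div_pos_of_neg_of_neg
    (mul_neg_of_pos_of_neg (by linarith) (by linarith)) hden, ?_⟩
  rw [div_lt_one_of_neg hden]
  have hcross : 0 < (b - c) * (r - a) := mul_pos (by linarith) (by linarith)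
  linarith
end

section
/- For C₂ ranging over the interval (3·4^{1/3}, ∞), let a(C₂) > b(C₂) > 0 > c(C₂) denote the three distinct real roots of the cubic x³ − C₂x + 4 and set r(C₂) = √C₂. Then the function C₂ ↦ (a(C₂) − b(C₂))(c(C₂) − r(C₂))/((a(C₂) − c(C₂))(b(C₂) − r(C₂))) is monotonically increasing on (3·4^{1/3}, ∞). -/
/-- The ratio of the theorem as a function of the parameter `s = (1 + α) / (α + β)`, where
`α > β > 0` are the positive roots divided by `√C₂`, a point of the conic `α² + αβ + β² = 1`. -/
noncomputable def conicRatio (s : ℝ) : ℝ :=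
  (2 * s ^ 2 - 2 * s - 1) * (s ^ 2 + s) / ((s ^ 2 + 2 * s - 2) * ((2 * s - 1) * (s - 1)))

lemma conicRatio_den_pos {s : ℝ} (hs : 1 < s) :
    0 < (s ^ 2 + 2 * s - 2) * ((2 * s - 1) * (s - 1)) :=
  mul_pos (by nlinarith) (mul_pos (by linarith) (by linarith))

lemma conicRatio_strictMonoOn : StrictMonoOn conicRatio (Set.Ioo 1 2) := by
  rintro s ⟨hs, hs'⟩ t ⟨ht, ht'⟩ hst
  unfold conicRatio
  rw [div_lt_div_iff₀ (conicRatio_den_pos hs) (conicRatio_den_pos ht), ← sub_pos]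
  obtain ⟨x, rfl⟩ : ∃ x, s = x + 1 := ⟨s - 1, by ring⟩
  obtain ⟨z, rfl⟩ : ∃ z, t = z + 1 := ⟨t - 1, by ring⟩
  obtain ⟨y, hy⟩ : ∃ y, y = 1 - x := ⟨_, rfl⟩
  obtain ⟨w, hw⟩ : ∃ w, w = 1 - z := ⟨_, rfl⟩
  have hx : 0 < x := by linarith
  have hz : 0 < z := by linarith
  have hy0 : 0 < y := by linarith
  have hw0 : 0 < w := by linarith
  -- The Bernstein coefficients of the quotient of the difference by `t - s` are positive.
  have key : 0 < (z - x) * (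
      2 * y ^ 3 * w ^ 3 + 18 * y ^ 3 * z * w ^ 2 + 48 * y ^ 3 * z ^ 2 * w + 36 * y ^ 3 * z ^ 3 +
      18 * x * y ^ 2 * w ^ 3 + 111 * x * y ^ 2 * z * w ^ 2 + 225 * x * y ^ 2 * z ^ 2 * w + 144 * x * y ^ 2 * z ^ 3 +
      48 * x ^ 2 * y * w ^ 3 + 225 * x ^ 2 * y * z * w ^ 2 + 333 * x ^ 2 * y * z ^ 2 * w + 162 * x ^ 2 * y * z ^ 3 +
      36 * x ^ 3 * w ^ 3 + 144 * x ^ 3 * z * w ^ 2 + 162 * x ^ 3 * z ^ 2 * w + 54 * x ^ 3 * z ^ 3) :=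
    mul_pos (by linarith) (by positivity)
  refine key.trans_eq ?_
  rw [hy, hw]
  ring

lemma ratio_eq_conicRatio {α β : ℝ} (hβ : 0 < β) (hαβ : β < α)
    (h : α ^ 2 + α * β + β ^ 2 = 1) :
    (1 + α) / (α + β) ∈ Set.Ioo 1 2 ∧
      (α - β) * (-(α + β) - 1) / ((α - -(α + β)) * (β - 1)) =
        conicRatio ((1 + α) / (α + β)) := by
  have hα : 0 < α := hβ.trans hαβ
  have hβ1 : β < 1 := by nlinarith [mul_pos hα hβ]
  have hg : 0 < α + β := by positivity
  have h1 : 1 < (1 + α) / (α + β) := by rw [lt_div_iff₀ hg]; linarith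
  have h2 : (1 + α) / (α + β) < 2 := by
    rw [div_lt_iff₀ hg]
    nlinarith [mul_pos hα hβ, pow_pos hβ 2]
  refine ⟨⟨h1, h2⟩, ?_⟩
  obtain ⟨s, hs⟩ : ∃ s, s = (1 + α) / (α + β) := ⟨_, rfl⟩
  rw [← hs] at h1 ⊢
  have hsα : s * (α + β) = 1 + α := by rw [hs]; field_simp
  obtain ⟨d, hd⟩ : ∃ d, d = s ^ 2 - s + 1 := ⟨_, rfl⟩
  have hD : d ≠ 0 := by nlinarith
  have hgD : α + β = (2 * s - 1) / d := by
    rw [eq_div_iff hD]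
    rw [hd]
    apply mul_left_cancel₀ hg.ne'
    linear_combination h + (s * (α + β) + α - (α + β) - 1) * hsα
  have hαD : α = (s ^ 2 - 1) / d := by
    rw [show α = s * (α + β) - 1 by linarith, hgD]
    field_simp
    rw [hd]
    ring
  have hβD : β = s * (2 - s) / d := by
    rw [show β = (α + β) - α by ring, hgD, hαD]
    field_simp
    ring
  have hden : (α - -(α + β)) * (β - 1) ≠ 0 :=
    mul_ne_zero (by linarith) (by linarith)
  unfold conicRatio
  rw [div_eq_div_iff hden (conicRatio_den_pos h1).ne', hαD, hβD]
  field_simp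
  rw [hd]
  ring

lemma conic_param_lt {α β α' β' : ℝ} (hβ : 0 < β) (hαβ : β < α)
    (h : α ^ 2 + α * β + β ^ 2 = 1) (hβ' : 0 < β') (hαβ' : β' < α')
    (h' : α' ^ 2 + α' * β' + β' ^ 2 = 1)
    (hlt : α' * β' * (α' + β') < α * β * (α + β)) :
    (1 + α) / (α + β) < (1 + α') / (α' + β') := by
  have hα : 0 < α := hβ.trans hαβ
  have hα' : 0 < α' := hβ'.trans hαβ'
  have hαlt : α < α' := by
    by_contra! hle
    have e : α * β * (α + β) = α - α ^ 3 := by linear_combination α * h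
    have e' : α' * β' * (α' + β') = α' - α' ^ 3 := by linear_combination α' * h'
    have hsq : 1 < 3 * α' ^ 2 := by nlinarith
    nlinarith [mul_nonneg (sub_nonneg.2 hle)
      (show 0 ≤ α ^ 2 + α * α' + α' ^ 2 - 1 by nlinarith)]
  have hglt : α' + β' < α + β := by
    by_contra! hle
    have e : α * β * (α + β) = (α + β) ^ 3 - (α + β) := by linear_combination -(α + β) * h
    have e' : α' * β' * (α' + β') = (α' + β') ^ 3 - (α' + β') := by
      linear_combination -(α' + β') * h'
    have hsq : 1 < (α + β) ^ 2 := by nlinarith [mul_pos hα hβ]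
    nlinarith [mul_nonneg (sub_nonneg.2 hle)
      (show 0 ≤ (α' + β') ^ 2 + (α' + β') * (α + β) + (α + β) ^ 2 - 1 by
        nlinarith [mul_pos hα hβ, mul_pos hα' hβ', show 0 < (α' + β') * (α + β) by positivity])]
  exact div_lt_div₀ (by linarith) hglt.le (by linarith) (by linarith)

/-- Dividing the roots by `√C` puts the positive ones on the conic `α² + αβ + β² = 1`. -/
lemma exists_conic_point {C a b c : ℝ} (hab : b < a) (hb : 0 < b) (hc : c < 0)
    (ha3 : a ^ 3 - C * a + 4 = 0) (hb3 : b ^ 3 - C * b + 4 = 0) (hc3 : c ^ 3 - C * c + 4 = 0) :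
    ∃ α β : ℝ, 0 < β ∧ β < α ∧ α ^ 2 + α * β + β ^ 2 = 1 ∧
      α * β * (α + β) * √C ^ 3 = 4 ∧
      (a - b) * (c - √C) / ((a - c) * (b - √C)) =
        (α - β) * (-(α + β) - 1) / ((α - -(α + β)) * (β - 1)) := by
  have ha : 0 < a := hb.trans hab
  have h1 : a ^ 2 + a * b + b ^ 2 = C :=
    mul_left_cancel₀ (sub_pos.2 hab).ne' (by linear_combination ha3 - hb3)
  have h2 : a ^ 2 + a * c + c ^ 2 = C :=
    mul_left_cancel₀ (show a - c ≠ 0 by linarith) (by linear_combination ha3 - hc3)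
  have h3 : c = -(a + b) :=
    mul_left_cancel₀ (show c - b ≠ 0 by linarith) (by linear_combination h2 - h1)
  have hC : 0 < C := by rw [← h1]; positivity
  have hr : 0 < √C := Real.sqrt_pos.2 hC
  have hr2 : √C ^ 2 = C := Real.sq_sqrt hC.le
  obtain ⟨r, hrr⟩ : ∃ r, r = √C := ⟨_, rfl⟩
  rw [← hrr] at hr hr2 ⊢
  refine ⟨a / r, b / r, by positivity, by gcongr, ?_, ?_, ?_⟩
  · field_simp
    linarith
  · field_simp
    linear_combination a * h1 - ha3
  · have e1 : a / r - b / r = (a - b) / r := by ring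
    have e2 : -(a / r + b / r) - 1 = (c - r) / r := by rw [h3]; field_simp
    have e3 : a / r - -(a / r + b / r) = (a - c) / r := by rw [h3]; ring
    have e4 : b / r - 1 = (b - r) / r := by field_simp
    rw [e1, e2, e3, e4, div_mul_div_comm, div_mul_div_comm,
      div_div_div_cancel_right₀ (by positivity)]


/-- With `a C₂ > b C₂ > 0 > c C₂` the three distinct real roots of
`x³ - C₂x + 4` and `r C₂ = √C₂`, the function
`C₂ ↦ (a-b)(c-r)/((a-c)(b-r))` is monotonically increasing on `(3·4^(1/3), ∞)`. -/
theorem stmt7 (a b c : ℝ → ℝ)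
    (hroots : ∀ C₂ ∈ Set.Ioi (3 * (4 : ℝ) ^ ((1 : ℝ) / 3)),
      a C₂ > b C₂ ∧ b C₂ > 0 ∧ 0 > c C₂ ∧
      (a C₂) ^ 3 - C₂ * a C₂ + 4 = 0 ∧
      (b C₂) ^ 3 - C₂ * b C₂ + 4 = 0 ∧
      (c C₂) ^ 3 - C₂ * c C₂ + 4 = 0) :
    StrictMonoOn (fun C₂ =>
      (a C₂ - b C₂) * (c C₂ - Real.sqrt C₂) /
        ((a C₂ - c C₂) * (b C₂ - Real.sqrt C₂)))
      (Set.Ioi (3 * (4 : ℝ) ^ ((1 : ℝ) / 3))) := by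
  intro x hx y hy hxy
  obtain ⟨ha, hb, hc, ha3, hb3, hc3⟩ := hroots x hx
  obtain ⟨ha', hb', hc', ha3', hb3', hc3'⟩ := hroots y hy
  obtain ⟨α, β, hβ, hαβ, h, he, hF⟩ := exists_conic_point ha hb hc ha3 hb3 hc3
  obtain ⟨α', β', hβ', hαβ', h', he', hF'⟩ := exists_conic_point ha' hb' hc' ha3' hb3' hc3'
  obtain ⟨hs, hG⟩ := ratio_eq_conicRatio hβ hαβ h
  obtain ⟨hs', hG'⟩ := ratio_eq_conicRatio hβ' hαβ' h'
  have hx0 : 0 < x := lt_trans (by positivity) hx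
  have hsqrt : √x ^ 3 < √y ^ 3 := by gcongr
  have hα' : 0 < α' := hβ'.trans hαβ'
  have hlt : α' * β' * (α' + β') < α * β * (α + β) := by
    refine lt_of_mul_lt_mul_right ?_ (show 0 ≤ √x ^ 3 by positivity)
    calc α' * β' * (α' + β') * √x ^ 3 < α' * β' * (α' + β') * √y ^ 3 := by gcongr
      _ = α * β * (α + β) * √x ^ 3 := by rw [he, he']
  show _ < _
  beta_reduce
  rw [hF, hF', hG, hG']
  exact conicRatio_strictMonoOn hs hs' (conic_param_lt hβ hαβ h hβ' hαβ' h' hlt)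
end

section
/- Fix R > 0 and C₁ ∈ ℝ. For C₂ > 0 sufficiently large, define d = √(C₁²R² + 3C₂), θ = arccos((108 − 9C₁C₂R² − 2C₁³R⁴)/(2R·(C₁²R² + 3C₂)^{3/2})), a = (2/3)·d·cos((θ − π)/3) − RC₁/6, b = (2/3)·d·cos((θ + π)/3) − RC₁/6, c = −(2/3)·d·cos(θ/3) − RC₁/6, and r = √(C₂ + R²C₁²/4). Then, as C₂ → +∞: a/r → 1, c/a → −1, b/a → 0, and R·a²·(r − a) → 2. -/
open Filter

/-- The trigonometric solution of a depressed cubic: if `3φ` differs from `θ` by `π`, then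
`x = (2/3) d cos φ` satisfies `x³ - (d²/3) x = -(2/27) d³ cos θ`. -/
lemma cubic_of_cos_third (d θ : ℝ) :
    (2 / 3 * d * Real.cos ((θ - Real.pi) / 3)) ^ 3
      - d ^ 2 / 3 * (2 / 3 * d * Real.cos ((θ - Real.pi) / 3)) =
      -(2 / 27) * (d ^ 3 * Real.cos θ) := by
  have h := Real.cos_three_mul ((θ - Real.pi) / 3)
  rw [show 3 * ((θ - Real.pi) / 3) = θ - Real.pi by ring, Real.cos_sub_pi] at h
  linear_combination (-(2 / 27) * d ^ 3) * h

/-- Asymptotics of `a, b, c, r` as `C₂ → +∞`: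
`a/r → 1`, `c/a → -1`, `b/a → 0`, and `R·a²·(r - a) → 2`. -/
theorem stmt8 (R C₁ : ℝ) (hR : 0 < R) (d θ a b c r : ℝ → ℝ)
    (hd : ∀ C₂, d C₂ = Real.sqrt (C₁ ^ 2 * R ^ 2 + 3 * C₂))
    (hθ : ∀ C₂, θ C₂ = Real.arccos ((108 - 9 * C₁ * C₂ * R ^ 2 - 2 * C₁ ^ 3 * R ^ 4) /
      (2 * R * (C₁ ^ 2 * R ^ 2 + 3 * C₂) ^ ((3 : ℝ) / 2))))
    (ha : ∀ C₂, a C₂ = 2 / 3 * d C₂ * Real.cos ((θ C₂ - Real.pi) / 3) - R * C₁ / 6)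
    (hb : ∀ C₂, b C₂ = 2 / 3 * d C₂ * Real.cos ((θ C₂ + Real.pi) / 3) - R * C₁ / 6)
    (hc : ∀ C₂, c C₂ = -(2 / 3) * d C₂ * Real.cos (θ C₂ / 3) - R * C₁ / 6)
    (hr : ∀ C₂, r C₂ = Real.sqrt (C₂ + R ^ 2 * C₁ ^ 2 / 4)) :
    Tendsto (fun C₂ => a C₂ / r C₂) atTop (nhds 1) ∧
    Tendsto (fun C₂ => c C₂ / a C₂) atTop (nhds (-1)) ∧
    Tendsto (fun C₂ => b C₂ / a C₂) atTop (nhds 0) ∧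
    Tendsto (fun C₂ => R * (a C₂) ^ 2 * (r C₂ - a C₂)) atTop (nhds 2) := by
  have hD : Tendsto (fun C₂ : ℝ => C₁ ^ 2 * R ^ 2 + 3 * C₂) atTop atTop :=
    tendsto_atTop_add_const_left _ _ (tendsto_id.const_mul_atTop (by norm_num))
  have hdtop : Tendsto d atTop atTop := by
    rw [funext hd]
    exact Real.tendsto_sqrt_atTop.comp hD
  have hdpos : ∀ᶠ C₂ in atTop, 0 < d C₂ := hdtop.eventually_gt_atTop 0
  have hdsq : ∀ᶠ C₂ in atTop, d C₂ ^ 2 = C₁ ^ 2 * R ^ 2 + 3 * C₂ := by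
    filter_upwards [hD.eventually_ge_atTop 0] with x hx
    rw [hd, Real.sq_sqrt hx]
  have hinv : Tendsto (fun C₂ => (d C₂)⁻¹) atTop (nhds 0) := tendsto_inv_atTop_zero.comp hdtop
  -- the argument of the inverse cosine
  have hpow : ∀ᶠ C₂ in atTop, (C₁ ^ 2 * R ^ 2 + 3 * C₂) ^ ((3 : ℝ) / 2) = d C₂ ^ 3 := by
    filter_upwards [hdsq, hdpos] with x hx hx0
    rw [← hx, ← Real.rpow_natCast (d x) 2, ← Real.rpow_mul hx0.le, ← Real.rpow_natCast (d x) 3]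
    norm_num
  have harg : Tendsto (fun C₂ => (108 - 9 * C₁ * C₂ * R ^ 2 - 2 * C₁ ^ 3 * R ^ 4) /
      (2 * R * (C₁ ^ 2 * R ^ 2 + 3 * C₂) ^ ((3 : ℝ) / 2))) atTop (nhds 0) := by
    have h : Tendsto (fun C₂ => (108 + C₁ ^ 3 * R ^ 4) / (2 * R) * (d C₂)⁻¹ ^ 3
        - 3 * C₁ * R / 2 * (d C₂)⁻¹) atTop (nhds 0) := by
      simpa using ((hinv.pow 3).const_mul ((108 + C₁ ^ 3 * R ^ 4) / (2 * R))).sub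
        (hinv.const_mul (3 * C₁ * R / 2))
    refine h.congr' ?_
    filter_upwards [hdsq, hdpos, hpow] with x hx hx0 hp
    rw [hp]
    field_simp
    rw [hx]
    ring
  have hθlim : Tendsto θ atTop (nhds (Real.pi / 2)) := by
    rw [funext hθ, ← Real.arccos_zero]
    exact (Real.continuous_arccos.tendsto 0).comp harg
  have hcosθ : ∀ᶠ C₂ in atTop, d C₂ ^ 3 * Real.cos (θ C₂) =
      (108 - 9 * C₁ * C₂ * R ^ 2 - 2 * C₁ ^ 3 * R ^ 4) / (2 * R) := by
    filter_upwards [hdpos, hpow, harg.eventually_const_le (show (-1 : ℝ) < 0 by norm_num),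
      harg.eventually_le_const (show (0 : ℝ) < 1 by norm_num)] with x hx0 hp h1 h2
    rw [hθ, Real.cos_arccos h1 h2, hp]
    field_simp
  -- limits relative to `d`
  have hs3sq : Real.sqrt 3 ^ 2 = 3 := Real.sq_sqrt (by norm_num)
  have hrd : Tendsto (fun C₂ => r C₂ / d C₂) atTop (nhds (Real.sqrt 3 / 3)) := by
    have h : Tendsto (fun C₂ => Real.sqrt (1 / 3 - C₁ ^ 2 * R ^ 2 / 12 * (d C₂)⁻¹ ^ 2)) atTop
        (nhds (Real.sqrt (1 / 3))) := by
      refine (Real.continuous_sqrt.tendsto _).comp ?_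
      simpa using ((hinv.pow 2).const_mul (C₁ ^ 2 * R ^ 2 / 12)).const_sub (3 : ℝ)⁻¹
    rw [show Real.sqrt (1 / 3) = Real.sqrt 3 / 3 by
      rw [Real.sqrt_eq_iff_mul_self_eq (by norm_num) (by positivity)]
      linear_combination -hs3sq / 9] at h
    refine h.congr' ?_
    filter_upwards [hdsq, hdpos] with x hx hx0
    rw [hr, eq_div_iff hx0.ne', ← Real.sqrt_sq hx0.le, ← Real.sqrt_mul' _ (sq_nonneg _),
      Real.sqrt_sq hx0.le]
    congr 1
    field_simp
    rw [hx]
    ring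
  have hlin (m l : ℝ) (u : ℝ → ℝ) (hu : Tendsto u atTop (nhds l)) :
      Tendsto (fun C₂ => (m * d C₂ * Real.cos (u C₂) - R * C₁ / 6) / d C₂) atTop
        (nhds (m * Real.cos l)) := by
    have h : Tendsto (fun C₂ => m * Real.cos (u C₂) - R * C₁ / 6 * (d C₂)⁻¹) atTop
        (nhds (m * Real.cos l)) := by
      simpa using (((Real.continuous_cos.tendsto l).comp hu).const_mul m).sub
        (hinv.const_mul (R * C₁ / 6))
    refine h.congr' ?_
    filter_upwards [hdpos] with x hx0
    field_simp
  have had : Tendsto (fun C₂ => a C₂ / d C₂) atTop (nhds (Real.sqrt 3 / 3)) := by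
    have h := hlin (2 / 3) _ _ ((hθlim.sub_const Real.pi).div_const 3)
    rw [show (Real.pi / 2 - Real.pi) / 3 = -(Real.pi / 6) by ring, Real.cos_neg,
      Real.cos_pi_div_six, show 2 / 3 * (Real.sqrt 3 / 2) = Real.sqrt 3 / 3 by ring] at h
    simpa only [ha] using h
  have hbd : Tendsto (fun C₂ => b C₂ / d C₂) atTop (nhds 0) := by
    have h := hlin (2 / 3) _ _ ((hθlim.add_const Real.pi).div_const 3)
    rw [show (Real.pi / 2 + Real.pi) / 3 = Real.pi / 2 by ring, Real.cos_pi_div_two,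
      mul_zero] at h
    simpa only [hb] using h
  have hcd : Tendsto (fun C₂ => c C₂ / d C₂) atTop (nhds (-(Real.sqrt 3 / 3))) := by
    have h := hlin (-(2 / 3)) _ _ (hθlim.div_const 3)
    rw [show Real.pi / 2 / 3 = Real.pi / 6 by ring, Real.cos_pi_div_six,
      show -(2 / 3) * (Real.sqrt 3 / 2) = -(Real.sqrt 3 / 3) by ring] at h
    simpa only [hc] using h
  have hne : Real.sqrt 3 / 3 ≠ 0 := by positivity
  have hquot (f g : ℝ → ℝ) (l m : ℝ) (hf : Tendsto (fun C₂ => f C₂ / d C₂) atTop (nhds l))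
      (hg : Tendsto (fun C₂ => g C₂ / d C₂) atTop (nhds m)) (hm : m ≠ 0) :
      Tendsto (fun C₂ => f C₂ / g C₂) atTop (nhds (l / m)) := by
    refine (hf.div hg hm).congr' ?_
    filter_upwards [hdpos] with x hx0
    exact div_div_div_cancel_right₀ hx0.ne' _ _
  have har : Tendsto (fun C₂ => a C₂ / r C₂) atTop (nhds 1) := by
    simpa only [div_self hne] using hquot a r _ _ had hrd hne
  have hra : Tendsto (fun C₂ => r C₂ / a C₂) atTop (nhds 1) := by
    simpa only [div_self hne] using hquot r a _ _ hrd had hne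
  refine ⟨har, ?_, ?_, ?_⟩
  · simpa only [neg_div, div_self hne] using hquot c a _ _ hcd had hne
  · simpa only [zero_div] using hquot b a _ _ hbd had hne
  have hatop : Tendsto a atTop atTop := by
    refine (hdtop.atTop_mul_pos (by positivity) had).congr' ?_
    filter_upwards [hdpos] with x hx0
    exact mul_div_cancel₀ _ hx0.ne'
  have hapos : ∀ᶠ C₂ in atTop, 0 < a C₂ := hatop.eventually_gt_atTop 0
  have hlim : Tendsto (fun C₂ => 4 / ((1 + R * C₁ / 2 * (a C₂)⁻¹) * (r C₂ / a C₂ + 1))) atTop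
      (nhds 2) := by
    have h := ((((tendsto_inv_atTop_zero.comp hatop).const_mul (R * C₁ / 2)).const_add 1).mul
      (hra.add_const 1))
    have h' := h.inv₀ (by norm_num) |>.const_mul 4
    simp only [← div_eq_mul_inv] at h'
    norm_num at h'
    exact h'
  refine hlim.congr' ?_
  filter_upwards [hapos, hcosθ, hdsq, hatop.eventually_gt_atTop (-(R * C₁ / 2)),
    hD.eventually_ge_atTop (C₁ ^ 2 * R ^ 2 / 4)] with x hx0 hx1 hx2 hx3 hx4
  have hr2 : r x ^ 2 = x + R ^ 2 * C₁ ^ 2 / 4 := by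
    rw [hr, Real.sq_sqrt (by linarith)]
  have hr0 : 0 ≤ r x := by
    rw [hr]
    exact Real.sqrt_nonneg _
  have hcub := cubic_of_cos_third (d x) (θ x)
  rw [show 2 / 3 * d x * Real.cos ((θ x - Real.pi) / 3) = a x + R * C₁ / 6 by rw [ha]; ring,
    hx1, hx2] at hcub
  have key : R * (a x + R * C₁ / 2) * (r x ^ 2 - a x ^ 2) = 4 := by
    rw [hr2]
    field_simp at hcub
    linear_combination (-(1 / 17496)) * hcub
  have h1 : 0 < a x + R * C₁ / 2 := by linarith
  have h2 : 0 < r x + a x := by linarith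
  rw [show (1 + R * C₁ / 2 * (a x)⁻¹) * (r x / a x + 1) =
    (a x + R * C₁ / 2) * (r x + a x) / a x ^ 2 by field_simp]
  rw [div_div_eq_mul_div, div_eq_iff (by positivity)]
  linear_combination (-(a x ^ 2)) * key
end

section
/- Let U : ℝ → ℝ be a twice continuously differentiable, 2π-periodic function. Then ∫₀^{2π} (U''(x)² − 3U'(x)² + 2U(x)²) dx ≥ 0, with equality if and only if there exist real numbers a and b such that U(x) = a·cos x + b·sin x for all x. -/
open MeasureTheory in
/-- Parseval's identity for a continuous real function on a period. -/
theorem hasSum_sq_fourierCoeffOn_ofReal {f : ℝ → ℝ} (hf : Continuous f) :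
    HasSum (fun n : ℤ => ‖fourierCoeffOn Real.two_pi_pos (fun x => (f x : ℂ)) n‖ ^ 2)
      ((2 * Real.pi)⁻¹ * ∫ x in (0 : ℝ)..(2 * Real.pi), f x ^ 2) := by
  have hfc : Continuous fun x => (f x : ℂ) := Complex.continuous_ofReal.comp hf
  have hL2 : MemLp (fun x => (f x : ℂ)) 2 (volume.restrict (Set.Ioc 0 (2 * Real.pi))) :=
    (memLp_two_iff_integrable_sq_norm hfc.aestronglyMeasurable).2
      (((hfc.norm.pow 2).integrableOn_Icc).mono_set Set.Ioc_subset_Icc_self)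
  simpa using hasSum_sq_fourierCoeffOn Real.two_pi_pos hL2

/-- Differentiating a periodic function multiplies its `n`-th Fourier coefficient by `n`, up to
a factor of modulus one. -/
theorem sq_norm_fourierCoeffOn_deriv {f : ℝ → ℝ} (hf : ContDiff ℝ 1 f)
    (hper : Function.Periodic f (2 * Real.pi)) (n : ℤ) :
    ‖fourierCoeffOn Real.two_pi_pos (fun x => ((deriv f x : ℝ) : ℂ)) n‖ ^ 2 =
      (n : ℝ) ^ 2 * ‖fourierCoeffOn Real.two_pi_pos (fun x => (f x : ℂ)) n‖ ^ 2 := by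
  have hd : ∀ x, HasDerivAt (fun x => (f x : ℂ)) ((deriv f x : ℝ) : ℂ) x := fun x =>
    HasDerivAt.ofReal_comp (f := f) (hf.differentiable one_ne_zero x).hasDerivAt
  have hc : Continuous fun x => ((deriv f x : ℝ) : ℂ) :=
    Complex.continuous_ofReal.comp (hf.continuous_deriv le_rfl)
  have hend : f (2 * Real.pi) = f 0 := by simpa using hper 0
  rcases eq_or_ne n 0 with rfl | hn
  · rw [fourierCoeffOn_eq_integral]
    have := intervalIntegral.integral_eq_sub_of_hasDerivAt (fun x _ => hd x)
      (hc.intervalIntegrable 0 (2 * Real.pi))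
    simp [this, hend]
  · rw [fourierCoeffOn_of_hasDerivAt Real.two_pi_pos hn (fun x _ => hd x)
      (hc.intervalIntegrable _ _)]
    have h1 : (n : ℝ) ≠ 0 := by exact_mod_cast hn
    have h2 := Real.pi_pos.ne'
    simp only [hend, sub_self, mul_zero, zero_sub, Complex.ofReal_zero, sub_zero, norm_mul,
      norm_neg, norm_div, norm_one, Complex.norm_I, mul_one, Complex.norm_real,
      Complex.norm_intCast, Complex.norm_ofNat, Complex.ofReal_mul, Complex.ofReal_ofNat,
      Real.norm_eq_abs, abs_of_pos Real.pi_pos, mul_pow, div_pow, sq_abs]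
    field_simp

/-- The derivative of a periodic function is periodic. -/
theorem Function.Periodic.deriv_periodic {f : ℝ → ℝ} {T : ℝ} (hf : Function.Periodic f T) :
    Function.Periodic (deriv f) T := fun x => by
  rw [← deriv_comp_add_const, funext hf]

/-- A continuous periodic function whose square integrates to zero over a period vanishes. -/
theorem Function.Periodic.eq_zero_of_integral_sq_eq_zero {f : ℝ → ℝ} {T : ℝ} (hT : 0 < T)
    (hf : Continuous f) (hper : Function.Periodic f T)
    (h : ∫ x in (0 : ℝ)..T, f x ^ 2 = 0) (x : ℝ) : f x = 0 := by
  by_contra hx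
  obtain ⟨y, hy, hxy⟩ := hper.exists_mem_Ico₀ hT x
  refine (intervalIntegral.integral_pos hT (hf.pow 2).continuousOn (fun _ _ => sq_nonneg _)
    ⟨y, Set.Ico_subset_Icc_self hy, ?_⟩).ne' h
  rw [hxy] at hx
  exact lt_of_le_of_ne (sq_nonneg _) (pow_ne_zero 2 hx).symm

/-- A function equal to minus its second derivative is a combination of `cos` and `sin`. -/
theorem exists_eq_cos_add_sin_of_deriv_deriv_eq_neg {U : ℝ → ℝ} (hU : ContDiff ℝ 2 U)
    (h : ∀ x, deriv (deriv U) x + U x = 0) :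
    ∃ a b : ℝ, ∀ x : ℝ, U x = a * Real.cos x + b * Real.sin x := by
  have h0 : ∀ x, HasDerivAt U (deriv U x) x := fun x =>
    (hU.differentiable two_ne_zero x).hasDerivAt
  have h1 : ∀ x, HasDerivAt (deriv U) (deriv (deriv U) x) x := fun x =>
    ((ContDiff.deriv' (n := 1) hU).differentiable one_ne_zero x).hasDerivAt
  have hP : ∀ x, HasDerivAt (fun x => U x * Real.cos x - deriv U x * Real.sin x) 0 x := fun x =>
    (((h0 x).mul (Real.hasDerivAt_cos x)).sub ((h1 x).mul (Real.hasDerivAt_sin x))).congr_deriv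
      (by linear_combination -Real.sin x * h x)
  have hQ : ∀ x, HasDerivAt (fun x => U x * Real.sin x + deriv U x * Real.cos x) 0 x := fun x =>
    (((h0 x).mul (Real.hasDerivAt_sin x)).add ((h1 x).mul (Real.hasDerivAt_cos x))).congr_deriv
      (by linear_combination Real.cos x * h x)
  refine ⟨U 0, deriv U 0, fun x => ?_⟩
  have eP := is_const_of_deriv_eq_zero (fun x => (hP x).differentiableAt)
    (fun x => (hP x).deriv) x 0
  have eQ := is_const_of_deriv_eq_zero (fun x => (hQ x).differentiableAt)
    (fun x => (hQ x).deriv) x 0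
  simp only [Real.cos_zero, Real.sin_zero, mul_one, mul_zero, sub_zero, zero_add] at eP eQ
  linear_combination Real.cos x * eP + Real.sin x * eQ - U x * Real.sin_sq_add_cos_sq x

/-- For a `C²`, `2π`-periodic function `U : ℝ → ℝ`,
`∫₀^{2π} (U''² - 3U'² + 2U²) ≥ 0`, with equality iff `U x = a·cos x + b·sin x`. -/
theorem stmt10 (U : ℝ → ℝ) (hU : ContDiff ℝ 2 U)
    (hper : Function.Periodic U (2 * Real.pi)) :
    0 ≤ (∫ x in (0 : ℝ)..(2 * Real.pi),
        (deriv (deriv U) x) ^ 2 - 3 * (deriv U x) ^ 2 + 2 * (U x) ^ 2) ∧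
    ((∫ x in (0 : ℝ)..(2 * Real.pi),
        (deriv (deriv U) x) ^ 2 - 3 * (deriv U x) ^ 2 + 2 * (U x) ^ 2) = 0 ↔
      ∃ a b : ℝ, ∀ x : ℝ, U x = a * Real.cos x + b * Real.sin x) := by
  have hU1 : ContDiff ℝ 1 (deriv U) := ContDiff.deriv' (n := 1) hU
  have c0 : Continuous U := hU.continuous
  have c1 : Continuous (deriv U) := hU1.continuous
  have c2 : Continuous (deriv (deriv U)) := hU1.continuous_deriv le_rfl
  have hparts : ∫ x in (0 : ℝ)..(2 * Real.pi),
      (deriv U x * deriv U x + U x * deriv (deriv U) x) = 0 := by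
    rw [intervalIntegral.integral_eq_sub_of_hasDerivAt (f := fun x => U x * deriv U x)
      (fun x _ => (hU.differentiable two_ne_zero x).hasDerivAt.mul
        (hU1.differentiable one_ne_zero x).hasDerivAt)
      (((c1.mul c1).add (c0.mul c2)).intervalIntegrable _ _)]
    have e0 : U (2 * Real.pi) = U 0 := by simpa using hper 0
    have e1 : deriv U (2 * Real.pi) = deriv U 0 := by simpa using hper.deriv_periodic 0
    simp [e0, e1]
  set A := ∫ x in (0 : ℝ)..(2 * Real.pi), U x ^ 2 with hA
  set B := ∫ x in (0 : ℝ)..(2 * Real.pi), deriv U x ^ 2 with hB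
  set C := ∫ x in (0 : ℝ)..(2 * Real.pi), deriv (deriv U) x ^ 2
  have i0 : IntervalIntegrable (fun x => U x ^ 2) MeasureTheory.volume 0 (2 * Real.pi) :=
    (c0.pow 2).intervalIntegrable _ _
  have i1 : IntervalIntegrable (fun x => deriv U x ^ 2) MeasureTheory.volume 0 (2 * Real.pi) :=
    (c1.pow 2).intervalIntegrable _ _
  have i2 : IntervalIntegrable (fun x => deriv (deriv U) x ^ 2) MeasureTheory.volume
      0 (2 * Real.pi) := (c2.pow 2).intervalIntegrable _ _
  have hI : (∫ x in (0 : ℝ)..(2 * Real.pi),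
      (deriv (deriv U) x) ^ 2 - 3 * (deriv U x) ^ 2 + 2 * (U x) ^ 2) = C - 3 * B + 2 * A := by
    rw [intervalIntegral.integral_add (i2.sub (i1.const_mul 3)) (i0.const_mul 2),
      intervalIntegral.integral_sub i2 (i1.const_mul 3), intervalIntegral.integral_const_mul,
      intervalIntegral.integral_const_mul]
  set c : ℤ → ℝ := fun n => ‖fourierCoeffOn Real.two_pi_pos (fun x => (U x : ℂ)) n‖ ^ 2
  have s0 : HasSum c ((2 * Real.pi)⁻¹ * A) := hasSum_sq_fourierCoeffOn_ofReal c0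
  have s1 : HasSum (fun n : ℤ => (n : ℝ) ^ 2 * c n) ((2 * Real.pi)⁻¹ * B) := by
    convert hasSum_sq_fourierCoeffOn_ofReal c1 using 2 with n
    exact (sq_norm_fourierCoeffOn_deriv (hU.of_le one_le_two) hper n).symm
  have s2 : HasSum (fun n : ℤ => (n : ℝ) ^ 2 * ((n : ℝ) ^ 2 * c n)) ((2 * Real.pi)⁻¹ * C) := by
    convert hasSum_sq_fourierCoeffOn_ofReal c2 using 2 with n
    rw [sq_norm_fourierCoeffOn_deriv hU1 hper.deriv_periodic n,
      sq_norm_fourierCoeffOn_deriv (hU.of_le one_le_two) hper n]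
  have s : HasSum (fun n : ℤ => ((n : ℝ) ^ 2 - 1) * ((n : ℝ) ^ 2 - 2) * c n)
      ((2 * Real.pi)⁻¹ * (C - 3 * B + 2 * A)) := by
    have e : (2 * Real.pi)⁻¹ * (C - 3 * B + 2 * A) = (2 * Real.pi)⁻¹ * C -
        3 * ((2 * Real.pi)⁻¹ * B) + 2 * ((2 * Real.pi)⁻¹ * A) := by ring
    rw [e]
    refine (congrArg (HasSum · _) (funext fun n => ?_)).mpr
      ((s2.sub (s1.mul_left 3)).add (s0.mul_left 2))
    ring
  have hn_pos : ∀ n : ℤ, n ^ 2 = 1 ∨ 0 < ((n : ℝ) ^ 2 - 1) * ((n : ℝ) ^ 2 - 2) := by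
    intro n
    have key : n ^ 2 = 1 ∨ 0 < (n ^ 2 - 1) * (n ^ 2 - 2) := by
      rcases lt_trichotomy (n ^ 2) 1 with h | h | h
      · exact .inr (mul_pos_of_neg_of_neg (by linarith) (by linarith))
      · exact .inl h
      · refine .inr (mul_pos (by linarith) ?_)
        have : 2 ≤ |n| := by
          by_contra! h'
          have : |n| ≤ 1 := by lia
          nlinarith [sq_abs n, abs_nonneg n]
        nlinarith [sq_abs n]
    exact_mod_cast key
  have hc_nonneg : ∀ n, 0 ≤ c n := fun n => sq_nonneg _
  have hterm : ∀ n : ℤ, 0 ≤ ((n : ℝ) ^ 2 - 1) * ((n : ℝ) ^ 2 - 2) * c n := by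
    intro n
    rcases hn_pos n with h | h
    · have h' : (n : ℝ) ^ 2 = 1 := by exact_mod_cast h
      simp [h']
    · exact mul_nonneg h.le (hc_nonneg n)
  have hpi : (0 : ℝ) < (2 * Real.pi)⁻¹ := inv_pos.2 Real.two_pi_pos
  refine ⟨hI ▸ nonneg_of_mul_nonneg_right (s.nonneg hterm) hpi, fun h => ?_, ?_⟩
  · rw [hI] at h
    rw [h, mul_zero] at s
    have hz := (hasSum_zero_iff_of_nonneg hterm).1 s
    have hcn : ∀ n : ℤ, (n : ℝ) ^ 2 * c n = c n := by
      intro n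
      rcases hn_pos n with h | h
      · have h' : (n : ℝ) ^ 2 = 1 := by exact_mod_cast h
        rw [h', one_mul]
      · have h' : c n = 0 := (mul_eq_zero.1 (congrFun hz n)).resolve_left h.ne'
        simp [h']
    have hAB : A = B :=
      mul_left_cancel₀ hpi.ne' (s0.unique (by simpa only [hcn] using s1))
    refine exists_eq_cos_add_sin_of_deriv_deriv_eq_neg hU
      (Function.Periodic.eq_zero_of_integral_sq_eq_zero Real.two_pi_pos (c2.add c0)
        (hper.deriv_periodic.deriv_periodic.add hper) ?_)
    calc ∫ x in (0 : ℝ)..(2 * Real.pi), (deriv (deriv U) x + U x) ^ 2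
        = ∫ x in (0 : ℝ)..(2 * Real.pi),
            (((deriv (deriv U) x) ^ 2 - 3 * (deriv U x) ^ 2 + 2 * (U x) ^ 2) +
            (deriv U x ^ 2 - U x ^ 2)) +
            2 * (deriv U x * deriv U x + U x * deriv (deriv U) x) := by
          congr 1; ext x; ring
      _ = 0 := by
          rw [intervalIntegral.integral_add
            ((((i2.sub (i1.const_mul 3)).add (i0.const_mul 2))).add (i1.sub i0))
            (IntervalIntegrable.const_mul (f := fun x => deriv U x * deriv U x +
              U x * deriv (deriv U) x) (((c1.mul c1).add (c0.mul c2)).intervalIntegrable _ _) 2),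
            intervalIntegral.integral_add ((i2.sub (i1.const_mul 3)).add (i0.const_mul 2))
            (i1.sub i0), intervalIntegral.integral_sub i1 i0, hI,
            intervalIntegral.integral_const_mul, hparts, h, ← hA, ← hB, hAB]
          simp
  · rintro ⟨a, b, hab⟩
    have d1 : deriv U = fun x => b * Real.cos x - a * Real.sin x := by
      ext x
      rw [funext hab]
      exact HasDerivAt.deriv ((((Real.hasDerivAt_cos x).const_mul a).add
        ((Real.hasDerivAt_sin x).const_mul b)).congr_deriv (by ring))
    have d2 : ∀ x, deriv (deriv U) x = - U x := by
      intro x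
      rw [d1, hab]
      exact HasDerivAt.deriv ((((Real.hasDerivAt_cos x).const_mul b).sub
        ((Real.hasDerivAt_sin x).const_mul a)).congr_deriv (by ring))
    calc _ = ∫ x in (0 : ℝ)..(2 * Real.pi),
            (-3) * (deriv U x * deriv U x + U x * deriv (deriv U) x) := by
          congr 1; ext x; rw [d2]; ring
      _ = 0 := by rw [intervalIntegral.integral_const_mul, hparts, mul_zero]
end

section
/- Let n and m be integers with 1 ≤ m ≤ n − 1, and let k₁, k₂ be nonzero real numbers satisfying 1 + k₁k₂ = 0 and (n − m)·k₁^m·k₂^{n−m−1} + m·k₁^{m−1}·k₂^{n−m} − (n + 1)·k₁^m·k₂^{n−m}·(m·k₁ + (n − m)·k₂) = 0. Then k₁² = (n + 1 − m)/(m + 1). -/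
/-- If `1 ≤ m ≤ n - 1` and nonzero reals `k₁, k₂` satisfy
`1 + k₁k₂ = 0` and the `g = 2` extremality relation, then `k₁² = (n+1-m)/(m+1)`. -/
theorem stmt16 (n m : ℤ) (hm₁ : 1 ≤ m) (hm₂ : m ≤ n - 1) (k₁ k₂ : ℝ)
    (hk₁ : k₁ ≠ 0) (hk₂ : k₂ ≠ 0) (hprod : 1 + k₁ * k₂ = 0)
    (hext : ((n : ℝ) - m) * k₁ ^ m * k₂ ^ (n - m - 1) +
        (m : ℝ) * k₁ ^ (m - 1) * k₂ ^ (n - m) -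
        ((n : ℝ) + 1) * k₁ ^ m * k₂ ^ (n - m) *
          ((m : ℝ) * k₁ + ((n : ℝ) - m) * k₂) = 0) :
    k₁ ^ 2 = ((n : ℝ) + 1 - m) / ((m : ℝ) + 1) := by
  have hn : (n : ℝ) ≠ 0 := by
    have : n ≠ 0 := by omega
    exact_mod_cast this
  have hm : (m : ℝ) + 1 ≠ 0 := by
    have : m + 1 ≠ 0 := by omega
    exact_mod_cast this
  have e₁ : k₁ ^ m = k₁ ^ (m - 1) * k₁ := by
    rw [← zpow_add_one₀ hk₁, sub_add_cancel]
  have e₂ : k₂ ^ (n - m) = k₂ ^ (n - m - 1) * k₂ := by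
    rw [← zpow_add_one₀ hk₂, sub_add_cancel]
  rw [e₁, e₂] at hext
  have hfactor : k₁ ^ (m - 1) * k₂ ^ (n - m - 1) * (((n : ℝ) - m) * k₁ + m * k₂ -
      ((n : ℝ) + 1) * (k₁ * k₂) * (m * k₁ + ((n : ℝ) - m) * k₂)) = 0 := by
    linear_combination hext
  have hlin := (mul_eq_zero.mp hfactor).resolve_left
    (mul_ne_zero (zpow_ne_zero _ hk₁) (zpow_ne_zero _ hk₂))
  have hprod' : k₁ * k₂ = -1 := by linear_combination hprod
  rw [hprod'] at hlin
  rw [eq_div_iff hm]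
  apply mul_left_cancel₀ hn
  linear_combination k₁ * hlin - ((m : ℝ) + ((n : ℝ) + 1) * (n - m)) * hprod
end

section
/- Let m be a positive integer and define P(x) = (3m + 1)x⁶ − 3(6m + 5)x⁴ + 3(9m + 5)x² − 1. Let k₁ be a real number with P(k₁) = 0, 1 + √3·k₁ ≠ 0 and 1 − √3·k₁ ≠ 0, and set k₂ = (k₁ − √3)/(1 + √3·k₁) and k₃ = (k₁ + √3)/(1 − √3·k₁). Then P(k₂) = 0 and P(k₃) = 0. Moreover, if k₁², k₂², k₃² are pairwise distinct, then with n = 3m one has k₁²k₂²k₃² = 1/(n + 1), k₁² + k₂² + k₃² = 3(2n + 5)/(n + 1), and k₁²k₂² + k₂²k₃² + k₁²k₃² = 3(3n + 5)/(n + 1). -/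
/-- The Möbius map `k ↦ (k - s) / (1 + s * k)` with `s ^ 2 = 3` preserves the roots of every
sextic `(3 * m + 1) * (x * (x ^ 2 - 3)) ^ 2 - (3 * x ^ 2 - 1) ^ 2`, here in expanded form. -/
theorem sextic_mobius_root {K : Type*} [Field K] {m s k : K} (hs : s ^ 2 = 3)
    (hd : 1 + s * k ≠ 0)
    (hk : (3 * m + 1) * k ^ 6 - 3 * (6 * m + 5) * k ^ 4 + 3 * (9 * m + 5) * k ^ 2 - 1 = 0) :
    (3 * m + 1) * ((k - s) / (1 + s * k)) ^ 6 - 3 * (6 * m + 5) * ((k - s) / (1 + s * k)) ^ 4 +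
      3 * (9 * m + 5) * ((k - s) / (1 + s * k)) ^ 2 - 1 = 0 := by
  have hA : (k - s) * ((k - s) ^ 2 - 3 * (1 + s * k) ^ 2) = -8 * (k * (k ^ 2 - 3)) := by
    linear_combination (9 * k - 3 * k ^ 3 + 3 * s * k ^ 2 - s) * hs
  have hB : (1 + s * k) * (3 * (k - s) ^ 2 - (1 + s * k) ^ 2) = -8 * (3 * k ^ 2 - 1) := by
    linear_combination (3 - 9 * k ^ 2 + 3 * s * k - s * k ^ 3) * hs
  have hsplit : (3 * m + 1) * (k - s) ^ 6 - 3 * (6 * m + 5) * (k - s) ^ 4 * (1 + s * k) ^ 2 +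
      3 * (9 * m + 5) * (k - s) ^ 2 * (1 + s * k) ^ 4 - (1 + s * k) ^ 6 = 0 := by
    linear_combination 64 * hk +
      (3 * m + 1) * ((k - s) * ((k - s) ^ 2 - 3 * (1 + s * k) ^ 2) - 8 * (k * (k ^ 2 - 3))) * hA -
      ((1 + s * k) * (3 * (k - s) ^ 2 - (1 + s * k) ^ 2) - 8 * (3 * k ^ 2 - 1)) * hB
  have hy : (k - s) / (1 + s * k) * (1 + s * k) = k - s := div_mul_cancel₀ _ hd
  generalize (k - s) / (1 + s * k) = y at hy ⊢
  rw [← hy] at hsplit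
  exact mul_left_cancel₀ (pow_ne_zero 6 hd) (by linear_combination hsplit)

/-- Vieta's formulas for a cubic with three distinct roots. -/
theorem cubic_vieta {K : Type*} [Field K] {p q r t a b c : K} (hp : p ≠ 0)
    (hab : a ≠ b) (hbc : b ≠ c) (hac : a ≠ c)
    (ha : p * a ^ 3 - q * a ^ 2 + r * a - t = 0)
    (hb : p * b ^ 3 - q * b ^ 2 + r * b - t = 0)
    (hc : p * c ^ 3 - q * c ^ 2 + r * c - t = 0) :
    a * b * c = t / p ∧ a + b + c = q / p ∧ a * b + b * c + a * c = r / p := by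
  have h₁ : p * (a ^ 2 + a * b + b ^ 2) - q * (a + b) + r = 0 :=
    mul_left_cancel₀ (sub_ne_zero.2 hab) (by linear_combination ha - hb)
  have h₂ : p * (a ^ 2 + a * c + c ^ 2) - q * (a + c) + r = 0 :=
    mul_left_cancel₀ (sub_ne_zero.2 hac) (by linear_combination ha - hc)
  have h₃ : p * (a + b + c) - q = 0 :=
    mul_left_cancel₀ (sub_ne_zero.2 hbc) (by linear_combination h₁ - h₂)
  have h₄ : p * (a * b + b * c + a * c) - r = 0 := by
    linear_combination (a + b) * h₃ - h₁
  refine ⟨?_, ?_, ?_⟩ <;> rw [eq_div_iff hp]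
  · linear_combination ha - a ^ 2 * h₃ + a * h₄
  · linear_combination h₃
  · linear_combination h₄


/-- The Möbius images `k₂, k₃` of a root `k₁` of
`P(x) = (3m+1)x⁶ - 3(6m+5)x⁴ + 3(9m+5)x² - 1` are again roots, and when
`k₁², k₂², k₃²` are pairwise distinct the stated symmetric-function identities
hold with `n = 3m`. -/
theorem stmt17 (m : ℕ) (hm : 0 < m) (P : ℝ → ℝ)
    (hP : ∀ x : ℝ, P x = (3 * (m : ℝ) + 1) * x ^ 6 - 3 * (6 * (m : ℝ) + 5) * x ^ 4 +
      3 * (9 * (m : ℝ) + 5) * x ^ 2 - 1)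
    (k₁ k₂ k₃ : ℝ) (hk₁ : P k₁ = 0)
    (hplus : 1 + Real.sqrt 3 * k₁ ≠ 0) (hminus : 1 - Real.sqrt 3 * k₁ ≠ 0)
    (hk₂ : k₂ = (k₁ - Real.sqrt 3) / (1 + Real.sqrt 3 * k₁))
    (hk₃ : k₃ = (k₁ + Real.sqrt 3) / (1 - Real.sqrt 3 * k₁)) :
    P k₂ = 0 ∧ P k₃ = 0 ∧
    (k₁ ^ 2 ≠ k₂ ^ 2 → k₂ ^ 2 ≠ k₃ ^ 2 → k₁ ^ 2 ≠ k₃ ^ 2 →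
      k₁ ^ 2 * k₂ ^ 2 * k₃ ^ 2 = 1 / (3 * (m : ℝ) + 1) ∧
      k₁ ^ 2 + k₂ ^ 2 + k₃ ^ 2 = 3 * (2 * (3 * (m : ℝ)) + 5) / (3 * (m : ℝ) + 1) ∧
      k₁ ^ 2 * k₂ ^ 2 + k₂ ^ 2 * k₃ ^ 2 + k₁ ^ 2 * k₃ ^ 2 =
        3 * (3 * (3 * (m : ℝ)) + 5) / (3 * (m : ℝ) + 1)) := by
  have hs : Real.sqrt 3 ^ 2 = 3 := Real.sq_sqrt (by norm_num)
  rw [hP] at hk₁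
  have h₂ := sextic_mobius_root hs hplus hk₁
  rw [← hk₂] at h₂
  have h₃ := sextic_mobius_root (s := -Real.sqrt 3) (by rw [neg_sq, hs])
    (by rwa [neg_mul, ← sub_eq_add_neg]) hk₁
  rw [sub_neg_eq_add, neg_mul, ← sub_eq_add_neg, ← hk₃] at h₃
  refine ⟨by rw [hP, h₂], by rw [hP, h₃], fun h12 h23 h13 => ?_⟩
  exact cubic_vieta (by positivity) h12 h23 h13
    (by linear_combination hk₁) (by linear_combination h₂) (by linear_combination h₃)
end

section
/- Let k₁ > √3 be a real number and set k₂ = (√3·k₁ − 1)/(k₁ + √3), k₃ = (k₁ − √3)/(1 + √3·k₁), k₄ = −1/k₁, k₅ = −1/k₂, k₆ = −1/k₃. Then k₁ + k₂ + k₃ + k₄ + k₅ + k₆ = 0 if and only if k₁ = 2 + √3; and in that case k₂ = 1, k₃ = 2 − √3, k₄ = −(2 − √3), k₅ = −1, k₆ = −(2 + √3). -/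
/-- For `k₁ > √3` and the six `g = 6` principal curvatures generated
from `k₁`, their sum vanishes iff `k₁ = 2 + √3`, in which case they take the
stated explicit values. -/
theorem stmt19 (k₁ k₂ k₃ k₄ k₅ k₆ : ℝ) (hk₁ : Real.sqrt 3 < k₁)
    (hk₂ : k₂ = (Real.sqrt 3 * k₁ - 1) / (k₁ + Real.sqrt 3))
    (hk₃ : k₃ = (k₁ - Real.sqrt 3) / (1 + Real.sqrt 3 * k₁))
    (hk₄ : k₄ = -(1 / k₁)) (hk₅ : k₅ = -(1 / k₂)) (hk₆ : k₆ = -(1 / k₃)) :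
    (k₁ + k₂ + k₃ + k₄ + k₅ + k₆ = 0 ↔ k₁ = 2 + Real.sqrt 3) ∧
    (k₁ = 2 + Real.sqrt 3 →
      k₂ = 1 ∧ k₃ = 2 - Real.sqrt 3 ∧ k₄ = -(2 - Real.sqrt 3) ∧
      k₅ = -1 ∧ k₆ = -(2 + Real.sqrt 3)) := by
  have hs : Real.sqrt 3 ^ 2 = 3 := Real.sq_sqrt (by norm_num)
  have hs1 : 1 < Real.sqrt 3 := Real.lt_sqrt_of_sq_lt (by norm_num)
  generalize Real.sqrt 3 = s at *
  have hk : 0 < k₁ := by linarith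
  have hsk : 0 < s * k₁ - 1 := by nlinarith
  have hks : 0 < k₁ - s := by linarith
  have hks' : 0 < k₁ + s := by linarith
  have hsk' : 0 < 1 + s * k₁ := by linarith
  have hd : 0 < k₁ ^ 2 - 3 := by nlinarith
  have hd' : 0 < 3 * k₁ ^ 2 - 1 := by linarith
  have h26 : k₂ + k₆ = -8 * k₁ / (k₁ ^ 2 - 3) := by
    rw [hk₆, hk₂, hk₃, one_div_div, ← sub_eq_add_neg, div_sub_div _ _ hks'.ne' hks.ne',
      div_eq_div_iff (mul_pos hks' hks).ne' hd.ne']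
    linear_combination (-2 * k₁ * (k₁ ^ 2 - 3) - 8 * k₁) * hs
  have h35 : k₃ + k₅ = -8 * k₁ / (3 * k₁ ^ 2 - 1) := by
    rw [hk₅, hk₂, hk₃, one_div_div, ← sub_eq_add_neg, div_sub_div _ _ hsk'.ne' hsk.ne',
      div_eq_div_iff (mul_pos hsk' hsk).ne' hd'.ne']
    linear_combination (-2 * k₁ * (3 * k₁ ^ 2 - 1) + 8 * k₁ ^ 3) * hs
  have hsum : k₁ + k₂ + k₃ + k₄ + k₅ + k₆ =
      3 * ((k₁ ^ 2 - 1) * (k₁ ^ 2 + 4 * k₁ + 1)) * (k₁ ^ 2 - 4 * k₁ + 1) /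
        (k₁ * (k₁ ^ 2 - 3) * (3 * k₁ ^ 2 - 1)) := by
    have hsplit : k₁ + k₂ + k₃ + k₄ + k₅ + k₆ = k₁ + k₄ + (k₂ + k₆) + (k₃ + k₅) := by ring
    rw [hsplit, h26, h35, hk₄]
    have hd_ne : k₁ ^ 2 * 3 - 1 ≠ 0 := by
      rw [mul_comm]
      exact hd'.ne'
    field_simp
    ring
  have hfac : k₁ ^ 2 - 4 * k₁ + 1 = (k₁ - (2 + s)) * (k₁ - (2 - s)) := by
    linear_combination hs
  have hpos : 0 < 3 * ((k₁ ^ 2 - 1) * (k₁ ^ 2 + 4 * k₁ + 1)) := by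
    have : 0 < k₁ ^ 2 - 1 := by linarith
    positivity
  have hden : 0 < k₁ * (k₁ ^ 2 - 3) * (3 * k₁ ^ 2 - 1) := by positivity
  have hne : k₁ - (2 - s) ≠ 0 := by
    intro h
    linarith
  refine ⟨?_, fun h => ?_⟩
  · rw [hsum, hfac, div_eq_zero_iff, or_iff_left hden.ne', mul_eq_zero, or_iff_right hpos.ne',
      mul_eq_zero, or_iff_left hne, sub_eq_zero]
  · have h2 : k₂ = 1 := by
      rw [hk₂, div_eq_one_iff_eq hks'.ne', h]
      linear_combination hs
    have h3 : k₃ = 2 - s := by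
      rw [hk₃, div_eq_iff hsk'.ne', h]
      linear_combination s * hs
    have hinv : (2 + s) * (2 - s) = 1 := by linear_combination -hs
    refine ⟨h2, h3, ?_, ?_, ?_⟩
    · rw [hk₄, h, one_div, inv_eq_of_mul_eq_one_right hinv]
    · rw [hk₅, h2, one_div_one]
    · rw [hk₆, h3, one_div, inv_eq_of_mul_eq_one_left hinv]
end
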